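/- Let n be an odd positive integer. Consider the group A = PGL_n(ℂ) × C₂, where C₂ = {1, ψ} is a cyclic group of order 2, equipped with the involutive automorphism σ(g, ε) = (ḡ, ε) acting by complex conjugation on the first factor and trivially on the second. Then the first cohomology set H¹(A, σ) has exactly two elements, represented by the 1-cocycles (1, 1) and (1, ψ). -/

import Mathlib

open Matrix

noncomputable section

/-- Entrywise complex conjugation as a ring automorphism of `n × n` complex matrices. -/
def conjMat (n : ℕ) : Matrix (Fin n) (Fin n) ℂ ≃+* Matrix (Fin n) (Fin n) ℂ :=
  (starRingAut : ℂ ≃+* ℂ).mapMatrix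

/-- Entrywise complex conjugation `g ↦ ḡ` as an automorphism of `GL n ℂ`. -/
def conjGL (n : ℕ) : GL (Fin n) ℂ ≃* GL (Fin n) ℂ :=
  Units.mapEquiv (conjMat n).toMulEquiv

/-- The projective general linear group `PGL n ℂ = GL n ℂ / center`. -/
abbrev PGL (n : ℕ) := GL (Fin n) ℂ ⧸ Subgroup.center (GL (Fin n) ℂ)

lemma center_le_comap {G : Type*} [Group G] (e : G ≃* G) :
    Subgroup.center G ≤ (Subgroup.center G).comap e.toMonoidHom := by
  intro x hx
  rw [Subgroup.mem_comap, Subgroup.mem_center_iff]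
  intro y
  rw [Subgroup.mem_center_iff] at hx
  have := congrArg e (hx (e.symm y))
  simpa [_root_.map_mul] using this

/-- The involution `σ` of `PGL n ℂ` induced by entrywise complex conjugation. -/
def conjPGL (n : ℕ) : PGL n →* PGL n :=
  QuotientGroup.map _ _ (conjGL n).toMonoidHom (center_le_comap (conjGL n))

/-- The canonical projection `π : GL n ℂ → PGL n ℂ`. -/
def PGLmk (n : ℕ) : GL (Fin n) ℂ →* PGL n := QuotientGroup.mk' _

/-- The cyclic group of order 2, written multiplicatively; `ψ` is its nontrivial element. -/
abbrev C₂ := Multiplicative (ZMod 2)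

def ψ : C₂ := Multiplicative.ofAdd 1

/-- The involution `σ(g, ε) = (ḡ, ε)` of `PGL_n(ℂ) × C₂`. -/
def σA (n : ℕ) : PGL n × C₂ →* PGL n × C₂ := (conjPGL n).prodMap (MonoidHom.id C₂)

lemma coe_conjGL {n : ℕ} (g : GL (Fin n) ℂ) :
    (conjGL n g : Matrix (Fin n) (Fin n) ℂ) = conjMat n g := rfl

lemma conjMat_smul {n : ℕ} (z : ℂ) (M : Matrix (Fin n) (Fin n) ℂ) :
    conjMat n (z • M) = star z • conjMat n M := by
  ext i j
  simp [conjMat]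

lemma conjMat_conjMat {n : ℕ} (M : Matrix (Fin n) (Fin n) ℂ) : conjMat n (conjMat n M) = M := by
  ext i j
  simp [conjMat]

lemma det_conjMat {n : ℕ} (M : Matrix (Fin n) (Fin n) ℂ) : (conjMat n M).det = star M.det :=
  ((starRingAut : ℂ ≃+* ℂ).map_det M).symm

lemma exists_det_smul_add_star_smul_ne_zero {ι : Type*} [Fintype ι] [DecidableEq ι]
    (P Q : Matrix ι ι ℂ) (hP : P.det ≠ 0) : ∃ z : ℂ, (z • P + star z • Q).det ≠ 0 := by
  open Polynomial in
  let p : ℂ[X] := ((X + C Complex.I) • P.map C + (X - C Complex.I) • Q.map C).det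
  have eval_p (t : ℂ) : p.eval t = ((t + Complex.I) • P + (t - Complex.I) • Q).det := by
    rw [← Polynomial.coe_evalRingHom, RingHom.map_det]
    congr 1
    ext i j
    simp
  have hp : p ≠ 0 := by
    intro h
    have := eval_p Complex.I
    rw [h, Polynomial.eval_zero, sub_self, zero_smul, add_zero, det_smul, eq_comm,
      mul_eq_zero] at this
    refine this.elim (fun h => pow_ne_zero _ ?_ h) hP
    simp [← two_mul]
  by_contra! h
  refine hp (Polynomial.eq_zero_of_infinite_isRoot p
    ((Set.infinite_range_of_injective Complex.ofReal_injective).mono ?_))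
  rintro _ ⟨t, rfl⟩
  simpa [Polynomial.IsRoot, eval_p, sub_eq_add_neg] using h (t + Complex.I)

/-- If `M * conj M` is scalar and `n` is odd, then the scalar is a positive real, since its `n`-th
power is `‖det M‖ ^ 2`. -/
lemma exists_pos_of_mul_conjMat {n : ℕ} (hn : Odd n) {M : Matrix (Fin n) (Fin n) ℂ}
    (hM : M.det ≠ 0) {c : ℂ} (h : M * conjMat n M = c • 1) :
    ∃ r : ℝ, 0 < r ∧ c = r := by
  have : Nonempty (Fin n) := ⟨⟨0, hn.pos⟩⟩
  have h_conj : conjMat n M * M = star c • 1 := by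
    simpa [conjMat_conjMat, conjMat_smul] using congrArg (conjMat n) h
  have h_smul : c • M = star c • M := by
    simpa [h, h_conj] using mul_assoc M (conjMat n M) M
  have hM0 : M ≠ 0 := by
    rintro rfl
    exact hM det_zero
  have hc : c = star c := smul_left_injective ℂ hM0 h_smul
  obtain ⟨r, rfl⟩ := Complex.conj_eq_iff_real.1 hc.symm
  refine ⟨r, ?_, rfl⟩
  have hdet := congrArg det h
  rw [det_mul, det_conjMat, det_smul, det_one, mul_one, Fintype.card_fin, Complex.star_def,
    Complex.mul_conj] at hdet
  have : Complex.normSq M.det = r ^ n := by exact_mod_cast hdet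
  exact hn.pow_pos_iff.1 (this ▸ Complex.normSq_pos.2 hM)

/-- For odd `n`, every cocycle of `PGL n ℂ` is a coboundary. -/
lemma exists_eq_mul_conjPGL_inv {n : ℕ} (hn : Odd n) {g : PGL n} (hg : g * conjPGL n g = 1) :
    ∃ a : PGL n, g = a * (conjPGL n a)⁻¹ := by
  obtain ⟨M, rfl⟩ := QuotientGroup.mk_surjective g
  have hcenter : M * conjGL n M ∈ Subgroup.center (GL (Fin n) ℂ) :=
    (QuotientGroup.eq_one_iff _).1 hg
  obtain ⟨c, hc⟩ := GeneralLinearGroup.mem_center_iff_val_mem_range_scalar.1 hcenter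
  have hM : (M : Matrix (Fin n) (Fin n) ℂ) * conjMat n M = c • 1 := by
    rw [smul_one_eq_diagonal]
    exact hc.symm
  obtain ⟨r, hr, rfl⟩ := exists_pos_of_mul_conjMat hn M.det_ne_zero hM
  obtain ⟨s, hs, rfl⟩ : ∃ s : ℝ, 0 < s ∧ r = s * s :=
    ⟨√r, Real.sqrt_pos.2 hr, (Real.mul_self_sqrt hr.le).symm⟩
  have hs0 : (s : ℂ) ≠ 0 := Complex.ofReal_ne_zero.2 hs.ne'
  obtain ⟨z, hz⟩ := exists_det_smul_add_star_smul_ne_zero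
    ((s : ℂ) • (1 : Matrix (Fin n) (Fin n) ℂ)) M (by simp [hs0])
  let a : GL (Fin n) ℂ := GeneralLinearGroup.mkOfDetNeZero _ hz
  have hstar : star (s : ℂ) = s := Complex.conj_ofReal s
  have ha : (M : Matrix (Fin n) (Fin n) ℂ) * conjMat n a = (s : ℂ) • (a : Matrix _ _ ℂ) := by
    change (M : Matrix (Fin n) (Fin n) ℂ) * conjMat n (z • (s : ℂ) • 1 + star z • M) =
      (s : ℂ) • (z • (s : ℂ) • 1 + star z • M)
    simp only [map_add, conjMat_smul, map_one, mul_add, mul_smul_comm, hM, mul_one, smul_add,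
      smul_smul, star_mul, star_star, Complex.ofReal_mul, hstar]
    rw [add_comm]
    congr 2
    ring
  refine ⟨(a : PGL n), eq_mul_inv_of_mul_eq (QuotientGroup.eq.2 ?_).symm⟩
  refine GeneralLinearGroup.mem_center_iff_val_mem_range_scalar.2 ⟨s, ?_⟩
  have hval : (a⁻¹ * (M * conjGL n a) : GL (Fin n) ℂ).val = (s : ℂ) • 1 := by
    rw [Units.val_mul, Units.val_mul, coe_conjGL, ha, mul_smul_comm, Units.inv_mul]
  rw [smul_one_eq_diagonal] at hval
  exact hval.symm

lemma snd_eq_of_eq_mul_σA_inv {n : ℕ} {c d a : PGL n × C₂} (h : c = a * d * (σA n a)⁻¹) :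
    c.2 = d.2 := by
  have := congrArg Prod.snd h
  simpa [σA, mul_comm, mul_left_comm] using this

lemma exists_eq_mul_σA_inv {n : ℕ} (hn : Odd n) {c : PGL n × C₂} (hc : c * σA n c = 1) :
    ∃ a : PGL n × C₂, c = a * ((1, c.2) : PGL n × C₂) * (σA n a)⁻¹ := by
  obtain ⟨a, ha⟩ := exists_eq_mul_conjPGL_inv hn (congrArg Prod.fst hc)
  exact ⟨(a, 1), Prod.ext (by simpa [σA] using ha) (by simp [σA])⟩

/-- for odd positive `n`, `H¹(PGL_n(ℂ) × C₂, σ)` has exactly two elements,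
represented by the `1`-cocycles `(1, 1)` and `(1, ψ)`: both are cocycles, and every
`1`-cocycle is equivalent to exactly one of them. -/
theorem H1_PGL_times_C2_odd (n : ℕ) (hpos : 0 < n) (hodd : Odd n) :
    (((1, 1) : PGL n × C₂) * σA n (1, 1) = 1) ∧
    (((1, ψ) : PGL n × C₂) * σA n (1, ψ) = 1) ∧
    ∀ c : PGL n × C₂, c * σA n c = 1 →
      Xor' (∃ a : PGL n × C₂, c = a * ((1, 1) : PGL n × C₂) * (σA n a)⁻¹)
        (∃ a : PGL n × C₂, c = a * ((1, ψ) : PGL n × C₂) * (σA n a)⁻¹) := by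
  have mul_self : ∀ ε : C₂, ε * ε = 1 := by decide
  have cocycle (ε : C₂) : ((1, ε) : PGL n × C₂) * σA n (1, ε) = 1 :=
    Prod.ext (by simp [σA]) (mul_self ε)
  have hψ : (1 : C₂) ≠ ψ := by decide
  have eq_one_or_ψ : ∀ ε : C₂, ε = 1 ∨ ε = ψ := by decide
  refine ⟨cocycle 1, cocycle ψ, fun c hc => ?_⟩
  have hex := exists_eq_mul_σA_inv hodd hc
  rcases eq_one_or_ψ c.2 with h | h
  · rw [h] at hex
    exact Or.inl ⟨hex, fun ⟨_, ha⟩ => hψ (h.symm.trans (snd_eq_of_eq_mul_σA_inv ha))⟩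
  · rw [h] at hex
    exact Or.inr ⟨hex, fun ⟨_, ha⟩ => hψ ((snd_eq_of_eq_mul_σA_inv ha).symm.trans h)⟩

end
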